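/- arXiv:1203.6324 — 3 statements merged into one kernel-verified Lean document; each statement's English description precedes it below -/
import Mathlib

section
/- The disjoint union of correct runs is a correct run of the flow-composite: if √₁ : R₁ → α satisfies ¬(ℓ ≤ √₁ ℓ) for every ℓ ∈ R₁, and √₂ : R₂ → β satisfies ¬(ℓ ≤ √₂ ℓ) for every ℓ ∈ R₂, then in the flow-composition order t on α ⊕ β one has ¬ t (inl ℓ) (inl (√₁ ℓ)) for every ℓ ∈ R₁ and ¬ t (inr ℓ) (inr (√₂ ℓ)) for every ℓ ∈ R₂; i.e., the combined matching of receives to sends introduces no new temporal cycles in the composite. -/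
/-- The one-step relation generating the flow-composition order on the
disjoint sum of two preorders, with flow links `s` going from the first
summand to the second. -/
def flowRel {α β : Type*} (ra : α → α → Prop) (rb : β → β → Prop)
    (s : α → β → Prop) : α ⊕ β → α ⊕ β → Prop
  | Sum.inl a, Sum.inl a' => ra a a'
  | Sum.inr b, Sum.inr b' => rb b b'
  | Sum.inl a, Sum.inr b => s a b
  | Sum.inr _, Sum.inl _ => False

/-- The flow-composition order: the reflexive-transitive closure of `flowRel`. -/
def flowOrder {α β : Type*} [Preorder α] [Preorder β] (s : α → β → Prop) :
    α ⊕ β → α ⊕ β → Prop :=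
  Relation.ReflTransGen (flowRel (· ≤ · : α → α → Prop) (· ≤ · : β → β → Prop) s)

theorem flowOrder_inl_inl {α β : Type*} [Preorder α] [Preorder β] {s : α → β → Prop}
    {a a' : α} : flowOrder s (Sum.inl a) (Sum.inl a') ↔ a ≤ a' := by
  refine ⟨fun h => ?_, fun h => Relation.ReflTransGen.single h⟩
  suffices H : ∀ y, flowOrder s (Sum.inl a) y → ∀ a', y = Sum.inl a' → a ≤ a' from
    H _ h _ rfl
  intro y hy
  induction hy with
  | refl => rintro a' ⟨⟩; exact le_rfl
  | @tail y z _ hyz ih =>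
    rintro a' rfl
    rcases y with c | c
    · exact (ih c rfl).trans hyz
    · exact hyz.elim

theorem flowOrder_inr_inr {α β : Type*} [Preorder α] [Preorder β] {s : α → β → Prop}
    {b b' : β} : flowOrder s (Sum.inr b) (Sum.inr b') ↔ b ≤ b' := by
  refine ⟨fun h => ?_, fun h => Relation.ReflTransGen.single h⟩
  suffices H : ∀ y, flowOrder s (Sum.inr b) y → ∃ b', y = Sum.inr b' ∧ b ≤ b' by
    obtain ⟨_, ⟨⟩, hb⟩ := H _ h
    exact hb
  intro y hy
  induction hy with
  | refl => exact ⟨b, rfl, le_rfl⟩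
  | @tail y z _ hyz ih =>
    obtain ⟨c, rfl, hc⟩ := ih
    rcases z with d | d
    · exact hyz.elim
    · exact ⟨d, rfl, hc.trans hyz⟩

/-- The disjoint union of correct runs is a correct run of the flow-composite:
matching receives to sends componentwise introduces no new temporal cycles. -/
theorem run_disjoint_union_correct {α β : Type*} [Preorder α] [Preorder β]
    (s : α → β → Prop)
    (R₁ : Set α) (sqrt₁ : α → α) (h₁ : ∀ ℓ ∈ R₁, ¬ (ℓ ≤ sqrt₁ ℓ))
    (R₂ : Set β) (sqrt₂ : β → β) (h₂ : ∀ ℓ ∈ R₂, ¬ (ℓ ≤ sqrt₂ ℓ)) :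
    (∀ ℓ ∈ R₁, ¬ flowOrder s (Sum.inl ℓ) (Sum.inl (sqrt₁ ℓ))) ∧
    (∀ ℓ ∈ R₂, ¬ flowOrder s (Sum.inr ℓ) (Sum.inr (sqrt₂ ℓ))) := by
  exact ⟨fun ℓ hℓ h => h₁ ℓ hℓ (flowOrder_inl_inl.mp h),
    fun ℓ hℓ h => h₂ ℓ hℓ (flowOrder_inr_inr.mp h)⟩
end

section
/- Flow-composition of preorders is associative: given preorders α, β, γ and link relations s₁ : α → β → Prop, s₂ : β → γ → Prop, s₃ : α → γ → Prop, the reflexive-transitive closure on (α ⊕ β) ⊕ γ obtained by first forming the flow-composition of α and β along s₁ and then flow-composing the result with γ along the combined link Sum.elim s₃ s₂, coincides (under transport along the canonical equivalence (α ⊕ β) ⊕ γ ≃ α ⊕ (β ⊕ γ)) with the closure obtained by first flow-composing β and γ along s₂ and then flow-composing α with the result along the combined link sending a to inl b when s₁ a b and a to inr c when s₃ a c. -/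
/-- The flow-composition order: the reflexive-transitive closure of `flowRel`. -/
def flowComp {α β : Type*} (ra : α → α → Prop) (rb : β → β → Prop)
    (s : α → β → Prop) : α ⊕ β → α ⊕ β → Prop :=
  Relation.ReflTransGen (flowRel ra rb s)

theorem flowComp_reflTransGen_left {α β : Type*} (ra : α → α → Prop) (rb : β → β → Prop)
    (s : α → β → Prop) :
    flowComp (Relation.ReflTransGen ra) rb s = flowComp ra rb s := by
  refine le_antisymm (Relation.reflTransGen_closed ?_) (Relation.ReflTransGen.mono ?_)
  · rintro (a | b) (a' | b') h
    · exact Relation.ReflTransGen.lift Sum.inl (fun _ _ h => h) _ _ h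
    · exact .single h
    · exact h.elim
    · exact .single h
  · rintro (a | b) (a' | b') h
    · exact .single h
    · exact h
    · exact h
    · exact h

theorem flowComp_reflTransGen_right {α β : Type*} (ra : α → α → Prop) (rb : β → β → Prop)
    (s : α → β → Prop) :
    flowComp ra (Relation.ReflTransGen rb) s = flowComp ra rb s := by
  refine le_antisymm (Relation.reflTransGen_closed ?_) (Relation.ReflTransGen.mono ?_)
  · rintro (a | b) (a' | b') h
    · exact .single h
    · exact .single h
    · exact h.elim
    · exact Relation.ReflTransGen.lift Sum.inr (fun _ _ h => h) _ _ h
  · rintro (a | b) (a' | b') h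
    · exact h
    · exact h
    · exact h
    · exact .single h

theorem flowRel_sumAssoc {α β γ : Type*} (ra : α → α → Prop) (rb : β → β → Prop)
    (rc : γ → γ → Prop) (s₁ : α → β → Prop) (s₂ : β → γ → Prop) (s₃ : α → γ → Prop)
    (x y : (α ⊕ β) ⊕ γ) :
    flowRel (flowRel ra rb s₁) rc (Sum.elim s₃ s₂) x y ↔
      flowRel ra (flowRel rb rc s₂) (fun a => Sum.elim (s₁ a) (s₃ a))
        (Equiv.sumAssoc α β γ x) (Equiv.sumAssoc α β γ y) := by
  rcases x with (a | b) | c <;> rcases y with (a' | b') | c' <;> rfl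

/-- Flow-composition of preorders is associative, up to the canonical
equivalence `(α ⊕ β) ⊕ γ ≃ α ⊕ (β ⊕ γ)`. -/
theorem flowComp_assoc {α β γ : Type*} [Preorder α] [Preorder β] [Preorder γ]
    (s₁ : α → β → Prop) (s₂ : β → γ → Prop) (s₃ : α → γ → Prop) :
    ∀ x y : (α ⊕ β) ⊕ γ,
      flowComp (flowComp (· ≤ · : α → α → Prop) (· ≤ · : β → β → Prop) s₁)
          (· ≤ · : γ → γ → Prop) (Sum.elim s₃ s₂) x y ↔
      flowComp (· ≤ · : α → α → Prop)
          (flowComp (· ≤ · : β → β → Prop) (· ≤ · : γ → γ → Prop) s₂)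
          (fun a => Sum.elim (s₁ a) (s₃ a))
          (Equiv.sumAssoc α β γ x) (Equiv.sumAssoc α β γ y) := by
  intro x y
  change flowComp (Relation.ReflTransGen _) _ _ x y ↔
    flowComp _ (Relation.ReflTransGen _) _ _ _
  rw [flowComp_reflTransGen_left, flowComp_reflTransGen_right]
  constructor
  · exact Relation.ReflTransGen.lift (Equiv.sumAssoc α β γ)
      (fun x y => (flowRel_sumAssoc _ _ _ s₁ s₂ s₃ x y).1) x y
  · intro h
    simpa [flowComp, Function.onFun] using Relation.ReflTransGen.lift (Equiv.sumAssoc α β γ).symm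
      (fun u v h => (flowRel_sumAssoc _ _ _ s₁ s₂ s₃ _ _).2 (by simpa using h)) _ _ h
end

section
/- M-types are completely iterative algebras: for every polynomial functor P (a PFunctor) with final coalgebra P.M, every type X, and every flat guarded system of equations e : X → P.Obj (X ⊕ P.M), there exists a unique function h : X → P.M such that for every x : X, h x = PFunctor.M.mk (P.map (Sum.elim h id) (e x)). -/
universe u

/-- A flat guarded system of equations over `P.M`, extended by the destructor of `P.M` to a
`P`-coalgebra on variables and parameters together. -/
def equationCoalgebra {P : PFunctor.{u}} {X : Type u} (e : X → P.Obj (X ⊕ P.M)) :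
    X ⊕ P.M → P.Obj (X ⊕ P.M) :=
  Sum.elim e fun m => P.map Sum.inr m.dest

theorem corec_equationCoalgebra_comp_inr {P : PFunctor.{u}} {X : Type u}
    (e : X → P.Obj (X ⊕ P.M)) :
    PFunctor.M.corec (equationCoalgebra e) ∘ Sum.inr = id := by
  refine (PFunctor.M.corec_unique PFunctor.M.dest _ fun m => ?_).trans
    (PFunctor.M.corec_unique PFunctor.M.dest id fun m => ?_).symm
  · simp [PFunctor.M.dest_corec, equationCoalgebra, PFunctor.map_map]
  · simp

theorem elim_eq_corec_of_solution {P : PFunctor.{u}} {X : Type u}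
    (e : X → P.Obj (X ⊕ P.M)) (h : X → P.M)
    (hh : ∀ x, h x = PFunctor.M.mk (P.map (Sum.elim h id) (e x))) :
    Sum.elim h id = PFunctor.M.corec (equationCoalgebra e) := by
  refine PFunctor.M.corec_unique _ _ ?_
  rintro (x | m)
  · rw [Sum.elim_inl, hh x, PFunctor.M.dest_mk, equationCoalgebra, Sum.elim_inl]
  · simp [equationCoalgebra, PFunctor.map_map]

/-- M-types are completely iterative algebras: every flat guarded system of
equations `e : X → P.Obj (X ⊕ P.M)` has a unique solution `h : X → P.M`. -/
theorem M_completely_iterative (P : PFunctor.{u}) (X : Type u)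
    (e : X → P.Obj (X ⊕ P.M)) :
    ∃! h : X → P.M, ∀ x : X, h x = PFunctor.M.mk (P.map (Sum.elim h id) (e x)) := by
  refine ⟨PFunctor.M.corec (equationCoalgebra e) ∘ Sum.inl, fun x => ?_, fun h hh => ?_⟩
  · have key : Sum.elim (PFunctor.M.corec (equationCoalgebra e) ∘ Sum.inl) id =
        PFunctor.M.corec (equationCoalgebra e) := by
      rw [← corec_equationCoalgebra_comp_inr e, Sum.elim_comp_inl_inr]
    rw [key, Function.comp_apply, PFunctor.M.corec_def, equationCoalgebra, Sum.elim_inl]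
  · rw [← elim_eq_corec_of_solution e h hh, Sum.elim_comp_inl]
end
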